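/- arXiv:2409.17807 — 2 statements merged into one kernel-verified Lean document; each statement's English description precedes it below -/
import Mathlib

section
/- Let Δ be an uncountable set, Δ⁺ = Δ ∪ {∞} its one-point compactification (Δ discrete), and let Δ⁺_(2) be the space of two-element subsets of Δ⁺ with the Vietoris topology. Then Δ⁺_(2) is not a normal topological space. -/
/-- Type synonym: the hyperspace of subsets of `Z` with the Vietoris topology. -/
def Hyper (Z : Type*) : Type _ := Set Z

/-- The underlying set of a point of the hyperspace. -/
def Hyper.toSet {Z : Type*} (A : Hyper Z) : Set Z := A

/-- The Vietoris topology, generated by the sets `{A | A ⊆ W}` and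
`{A | A ∩ W ≠ ∅}` for open `W`. -/
instance instHyperTop (Z : Type*) [TopologicalSpace Z] : TopologicalSpace (Hyper Z) :=
  TopologicalSpace.generateFrom
    {s | ∃ W : Set Z, IsOpen W ∧
      (s = {A : Hyper Z | A.toSet ⊆ W} ∨ s = {A : Hyper Z | (A.toSet ∩ W).Nonempty})}

/-- `Z_[n]`: nonempty subsets of `Z` of cardinality at most `n`, with the
Vietoris topology. -/
def SubLe (Z : Type*) [TopologicalSpace Z] (n : ℕ) : Type _ :=
  {A : Hyper Z // A.toSet.Nonempty ∧ A.toSet.Finite ∧ A.toSet.ncard ≤ n}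

instance (Z : Type*) [TopologicalSpace Z] (n : ℕ) : TopologicalSpace (SubLe Z n) :=
  inferInstanceAs (TopologicalSpace
    {A : Hyper Z // A.toSet.Nonempty ∧ A.toSet.Finite ∧ A.toSet.ncard ≤ n})

/-- `Z_(k)`: subsets of `Z` of cardinality exactly `k`, with the Vietoris topology. -/
def SubEq (Z : Type*) [TopologicalSpace Z] (k : ℕ) : Type _ :=
  {A : Hyper Z // A.toSet.Finite ∧ A.toSet.ncard = k}

instance (Z : Type*) [TopologicalSpace Z] (k : ℕ) : TopologicalSpace (SubEq Z k) :=
  inferInstanceAs (TopologicalSpace {A : Hyper Z // A.toSet.Finite ∧ A.toSet.ncard = k})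

/-- The incidence correspondence `Z_[n]^⊆ = {(z, x) : z ∈ x}`. -/
def Inc (Z : Type*) [TopologicalSpace Z] (n : ℕ) : Type _ :=
  {p : Z × SubLe Z n // p.1 ∈ (p.2.1).toSet}

instance (Z : Type*) [TopologicalSpace Z] (n : ℕ) : TopologicalSpace (Inc Z n) :=
  inferInstanceAs (TopologicalSpace {p : Z × SubLe Z n // p.1 ∈ (p.2.1).toSet})

/-- The projection `Z_[n]^⊆ → Z_[n]`. -/
def IncProj (Z : Type*) [TopologicalSpace Z] (n : ℕ) : Inc Z n → SubLe Z n :=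
  fun p => p.1.2

open Filter Topology in
theorem stmt6_aux (Δ : Type*) [TopologicalSpace Δ] [DiscreteTopology Δ]
    (U : Set (Hyper (OnePoint Δ))) (hU : IsOpen U) (a : Δ)
    (h : (({(a : OnePoint Δ), OnePoint.infty} : Set (OnePoint Δ)) : Hyper (OnePoint Δ)) ∈ U) :
    ∃ K : Set Δ, K.Finite ∧ ∀ x ∉ K,
      (({(a : OnePoint Δ), (x : OnePoint Δ)} : Set (OnePoint Δ)) : Hyper (OnePoint Δ)) ∈ U := by
  let f : OnePoint Δ → Hyper (OnePoint Δ) := fun x => ({(a : OnePoint Δ), x} : Set (OnePoint Δ))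
  have hf : Continuous f := by
    refine continuous_generateFrom_iff.2 ?_
    rintro s ⟨W, hW, rfl | rfl⟩
    · have : f ⁻¹' {A | A.toSet ⊆ W} = {x | (a : OnePoint Δ) ∈ W ∧ x ∈ W} := by
        ext x
        change ({(a : OnePoint Δ), x} : Set (OnePoint Δ)) ⊆ W ↔ _
        simp [Set.insert_subset_iff]
      rw [this]
      exact isOpen_const.inter hW
    · have : f ⁻¹' {A | (A.toSet ∩ W).Nonempty} = {x | (a : OnePoint Δ) ∈ W} ∪ W := by
        ext x
        change (({(a : OnePoint Δ), x} : Set (OnePoint Δ)) ∩ W).Nonempty ↔ _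
        constructor
        · rintro ⟨y, rfl | rfl, hy⟩
          · exact Or.inl hy
          · exact Or.inr hy
        · rintro (hy | hy)
          · exact ⟨_, Or.inl rfl, hy⟩
          · exact ⟨_, Or.inr rfl, hy⟩
      rw [this]
      exact isOpen_const.union hW
  have ho : IsOpen (f ⁻¹' U) := hU.preimage hf
  have hc := (OnePoint.isOpen_iff_of_mem (s := f ⁻¹' U) h).1 ho
  refine ⟨((↑) ⁻¹' (f ⁻¹' U) : Set Δ)ᶜ, isCompact_iff_finite.1 hc.2, ?_⟩
  intro x hx
  exact not_not.1 hx

/-- The closed set of pairs `{s, ∞}` with `s ∈ S`. -/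
def stmt6F (Δ : Type*) [TopologicalSpace Δ] (S : Set Δ) : Set (SubEq (OnePoint Δ) 2) :=
  {P | ¬ P.1.toSet ⊆ Set.range ((↑) : Δ → OnePoint Δ) ∧
    ¬ (P.1.toSet ∩ ((↑) : Δ → OnePoint Δ) '' Sᶜ).Nonempty}

theorem stmt6F_closed (Δ : Type*) [TopologicalSpace Δ] (S : Set Δ) [DiscreteTopology Δ] :
    IsClosed (stmt6F Δ S) := by
  have h1 : IsOpen {P : SubEq (OnePoint Δ) 2 |
      P.1.toSet ⊆ Set.range ((↑) : Δ → OnePoint Δ)} :=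
    IsOpen.preimage (f := fun P : SubEq (OnePoint Δ) 2 => P.1) continuous_subtype_val
      (TopologicalSpace.isOpen_generateFrom_of_mem ⟨_, OnePoint.isOpen_range_coe, Or.inl rfl⟩)
  have h2 : IsOpen {P : SubEq (OnePoint Δ) 2 |
      (P.1.toSet ∩ ((↑) : Δ → OnePoint Δ) '' Sᶜ).Nonempty} :=
    IsOpen.preimage (f := fun P : SubEq (OnePoint Δ) 2 => P.1) continuous_subtype_val
      (TopologicalSpace.isOpen_generateFrom_of_mem
        ⟨_, OnePoint.isOpen_image_coe.2 (isOpen_discrete _), Or.inr rfl⟩)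
  exact h1.isClosed_compl.inter h2.isClosed_compl

/-- A pair as a point of the space. -/
def stmt6P (Δ : Type*) [TopologicalSpace Δ] (x y : OnePoint Δ) (h : x ≠ y) :
    SubEq (OnePoint Δ) 2 :=
  ⟨({x, y} : Set (OnePoint Δ)), Set.toFinite ({x, y} : Set (OnePoint Δ)), Set.ncard_pair h⟩

theorem stmt6F_mem (Δ : Type*) [TopologicalSpace Δ] (S : Set Δ) (a : Δ) (ha : a ∈ S) :
    stmt6P Δ a OnePoint.infty (OnePoint.coe_ne_infty a) ∈ stmt6F Δ S := by
  constructor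
  · intro h
    obtain ⟨x, hx⟩ := h (Or.inr rfl)
    exact OnePoint.coe_ne_infty x hx
  · rintro ⟨y, hy, x, hx, rfl⟩
    rcases hy with hy | hy
    · exact hx (OnePoint.coe_injective hy ▸ ha)
    · exact OnePoint.coe_ne_infty x hy

/-- For uncountable discrete `Δ`, the space of two-element subsets of the
one-point compactification `Δ⁺`, with the Vietoris topology, is not normal. -/
theorem stmt6 (Δ : Type*) [TopologicalSpace Δ] [DiscreteTopology Δ] [Uncountable Δ] :
    ¬ NormalSpace (SubEq (OnePoint Δ) 2) := by
  intro hN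
  let e := Infinite.natEmbedding Δ
  let A : Set Δ := Set.range e
  have hAc : A.Countable := Set.countable_range e
  have hAi : A.Infinite := Set.infinite_range_of_injective e.injective
  have hd : Disjoint (stmt6F Δ A) (stmt6F Δ Aᶜ) := by
    rw [Set.disjoint_left]
    rintro P ⟨-, h1⟩ ⟨-, h2⟩
    have h3 : P.1.toSet ⊆ {OnePoint.infty} := by
      intro x hx
      induction x using OnePoint.rec with
      | infty => rfl
      | coe x =>
        exfalso
        by_cases hxA : x ∈ A
        · exact h2 ⟨x, hx, x, not_not.2 hxA, rfl⟩
        · exact h1 ⟨x, hx, x, hxA, rfl⟩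
    have h4 := Set.ncard_le_ncard h3 (Set.finite_singleton _)
    rw [P.2.2, Set.ncard_singleton] at h4
    omega
  obtain ⟨U, V, hU, hV, hAU, hBV, hUV⟩ :=
    hN.normal _ _ (stmt6F_closed Δ A) (stmt6F_closed Δ Aᶜ) hd
  obtain ⟨U', hU', rfl⟩ := isOpen_induced_iff.1 hU
  obtain ⟨V', hV', rfl⟩ := isOpen_induced_iff.1 hV
  have hK : ∀ n, ∃ K : Set Δ, K.Finite ∧ ∀ x ∉ K,
      (({(e n : OnePoint Δ), (x : OnePoint Δ)} : Set (OnePoint Δ)) : Hyper (OnePoint Δ)) ∈ U' :=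
    fun n => stmt6_aux Δ U' hU' (e n) (hAU (stmt6F_mem Δ A (e n) ⟨n, rfl⟩))
  choose K hKf hKU using hK
  have hc : (A ∪ ⋃ n, K n).Countable :=
    hAc.union (Set.countable_iUnion fun n => (hKf n).countable)
  obtain ⟨b, hb⟩ : ∃ b, b ∉ A ∪ ⋃ n, K n := by
    by_contra! h
    exact Set.not_countable_univ (hc.mono fun x _ => h x)
  have hbA : b ∉ A := fun h => hb (Or.inl h)
  obtain ⟨L, hLf, hLV⟩ := stmt6_aux Δ V' hV' b (hBV (stmt6F_mem Δ Aᶜ b hbA))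
  obtain ⟨a, ⟨n, rfl⟩, haL⟩ := hAi.exists_notMem_finite hLf
  have hne : (e n : OnePoint Δ) ≠ (b : OnePoint Δ) :=
    fun h => hbA ⟨n, OnePoint.coe_injective h⟩
  refine (Set.disjoint_left.1 hUV : ∀ ⦃a⦄, _) (show stmt6P Δ (e n) b hne ∈ _ from ?_) ?_
  · exact hKU n b fun h => hb (Or.inr (Set.mem_iUnion.2 ⟨n, h⟩))
  · have := hLV (e n) haL
    rw [Set.pair_comm] at this
    exact this
end

section
/- Let Δ be an uncountable set and Δ⁺ its one-point compactification (with Δ discrete). There is no continuous map E from Δ⁺_[3] (the space of nonempty subsets of Δ⁺ of cardinality at most 3, with the Vietoris topology) to the space of probability measures on Δ⁺ (with the weak* topology) such that for every S ∈ Δ⁺_[3], the measure E(S) is supported on S. -/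
open Filter Topology MeasureTheory

namespace Stmt8Aux

/-- The point `{a, b, c}` of the hyperspace. -/
def tri {Z : Type*} [TopologicalSpace Z] (a b c : Z) : SubLe Z 3 :=
  ⟨(({a, b, c} : Set Z) : Hyper Z), ⟨a, Or.inl rfl⟩,
    Set.toFinite ({a, b, c} : Set Z), by
      change ({a, b, c} : Set Z).ncard ≤ 3
      have h1 := Set.ncard_insert_le a ({b, c} : Set Z)
      have h2 := Set.ncard_insert_le b ({c} : Set Z)
      have h3 := Set.ncard_singleton c
      omega⟩

theorem tri_toSet {Z : Type*} [TopologicalSpace Z] (a b c : Z) :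
    (tri a b c).1.toSet = ({a, b, c} : Set Z) := rfl

theorem tri_ext {Z : Type*} [TopologicalSpace Z] {a b c a' b' c' : Z}
    (h : ({a, b, c} : Set Z) = {a', b', c'}) : tri a b c = tri a' b' c' :=
  Subtype.ext h

theorem coe_tendsto (Δ : Type*) [TopologicalSpace Δ] [DiscreteTopology Δ] :
    Tendsto (fun x : Δ => (x : OnePoint Δ)) cofinite (𝓝 OnePoint.infty) := by
  have h := OnePoint.tendsto_coe_infty (X := Δ)
  rwa [coclosedCompact_eq_cocompact, cocompact_eq_cofinite] at h

theorem tri_tendsto (Δ : Type*) [TopologicalSpace Δ] [DiscreteTopology Δ] (a : Δ) :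
    Tendsto (fun p : Δ × Δ => tri (a : OnePoint Δ) p.1 p.2) (cofinite ×ˢ cofinite)
      (𝓝 (tri (a : OnePoint Δ) OnePoint.infty OnePoint.infty)) := by
  refine tendsto_subtype_rng.2 ?_
  refine TopologicalSpace.tendsto_nhds_generateFrom_iff.2 ?_
  rintro s ⟨W, hW, rfl | rfl⟩ hs
  · have hs' : ({(a : OnePoint Δ), OnePoint.infty, OnePoint.infty} : Set _) ⊆ W := hs
    have ha : (a : OnePoint Δ) ∈ W := hs' (by simp)
    have hi : OnePoint.infty ∈ W := hs' (by simp)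
    have h := (coe_tendsto Δ).eventually (hW.mem_nhds hi)
    filter_upwards [h.prod_mk h] with p hp
    change ({(a : OnePoint Δ), (p.1 : OnePoint Δ), (p.2 : OnePoint Δ)} : Set _) ⊆ W
    rintro x (rfl | rfl | rfl)
    exacts [ha, hp.1, hp.2]
  · have hs' : (({(a : OnePoint Δ), OnePoint.infty, OnePoint.infty} : Set _) ∩ W).Nonempty := hs
    obtain ⟨x, hx, hxW⟩ := hs'
    have hx' : x = (a : OnePoint Δ) ∨ x = OnePoint.infty := by simpa using hx
    rcases hx' with rfl | rfl
    · exact Eventually.of_forall fun p => ⟨_, Or.inl rfl, hxW⟩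
    · have h := (coe_tendsto Δ).eventually (hW.mem_nhds hxW)
      filter_upwards [h.prod_mk h] with p hp
      exact ⟨_, Or.inr (Or.inl rfl), hp.1⟩

theorem free_triple {Δ : Type*} [Uncountable Δ] (F : Δ → Set Δ) (hF : ∀ a, (F a).Finite) :
    ∃ a b c, b ∉ F a ∧ c ∉ F a ∧ a ∉ F b ∧ c ∉ F b ∧ a ∉ F c ∧ b ∉ F c := by
  have key : ∀ C : Set Δ, C.Countable → ∃ A : Set Δ, A.Countable ∧ A.Infinite ∧ ∀ x ∈ A, x ∉ C := by
    intro C hC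
    have h1 : (Cᶜ).Infinite := fun hfin => by
      have : (Set.univ : Set Δ).Countable := by
        rw [← Set.union_compl_self C]; exact hC.union hfin.countable
      exact Set.not_countable_univ this
    let e := h1.natEmbedding
    refine ⟨Set.range fun n => (e n : Δ), Set.countable_range _,
      Set.infinite_range_of_injective (Subtype.val_injective.comp e.injective), ?_⟩
    rintro _ ⟨n, rfl⟩
    exact (e n).2
  obtain ⟨A, hAc, hAi, -⟩ := key ∅ Set.countable_empty
  have hUA : (⋃ a ∈ A, F a).Countable := hAc.biUnion fun a _ => (hF a).countable
  obtain ⟨B, hBc, hBi, hB⟩ := key _ hUA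
  have hUB : (⋃ b ∈ B, F b).Countable := hBc.biUnion fun a _ => (hF a).countable
  obtain ⟨C, -, hCi, hC⟩ := key _ (hUA.union hUB)
  obtain ⟨c, hc⟩ := hCi.nonempty
  obtain ⟨b, hb, hbc⟩ := (hBi.sdiff (hF c)).nonempty
  obtain ⟨a, ha, hab⟩ := (hAi.sdiff ((hF b).union (hF c))).nonempty
  have h1 := hC c hc
  have h2 := hB b hb
  simp only [Set.mem_union, Set.mem_iUnion, not_or, not_exists] at h1 h2 hab
  exact ⟨a, b, c, h2 a ha, h1.1 a ha, hab.1, h1.2 b hb, hab.2, hbc⟩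

end Stmt8Aux

open Stmt8Aux
/-- For uncountable discrete `Δ`, there is no weak*-continuous assignment to
each `S ∈ Δ⁺_[3]` of a probability measure on `Δ⁺` supported on `S`. -/
theorem stmt8 (Δ : Type*) [TopologicalSpace Δ] [DiscreteTopology Δ] [Uncountable Δ] :
    letI : MeasurableSpace (OnePoint Δ) := borel (OnePoint Δ)
    haveI : BorelSpace (OnePoint Δ) := ⟨rfl⟩
    ¬ ∃ E : SubLe (OnePoint Δ) 3 → MeasureTheory.ProbabilityMeasure (OnePoint Δ),
        Continuous E ∧
        ∀ S : SubLe (OnePoint Δ) 3,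
          (E S : MeasureTheory.Measure (OnePoint Δ)) (S.1.toSet)ᶜ = 0 := by
  letI : MeasurableSpace (OnePoint Δ) := borel (OnePoint Δ)
  haveI : BorelSpace (OnePoint Δ) := ⟨rfl⟩
  rintro ⟨E, hE, hsupp⟩
  let w : Δ → SubLe (OnePoint Δ) 3 → ℝ := fun a S =>
    (E S : Measure (OnePoint Δ)).real {(a : OnePoint Δ)}
  have hw : ∀ a, Continuous (w a) := by
    intro a
    have hcl : IsClopen ({(a : OnePoint Δ)} : Set (OnePoint Δ)) := by
      refine ⟨isClosed_singleton, ?_⟩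
      rw [← Set.image_singleton]
      exact OnePoint.isOpenEmbedding_coe.isOpenMap _ (isOpen_discrete _)
    let f : BoundedContinuousFunction (OnePoint Δ) ℝ :=
      BoundedContinuousFunction.mkOfCompact
        ⟨Set.indicator {(a : OnePoint Δ)} (fun _ => (1 : ℝ)),
          (continuous_const (y := (1 : ℝ))).indicator (fun x hx => by
            rw [hcl.frontier_eq] at hx; exact hx.elim)⟩
    have hf : ∀ S, w a S = ∫ x, f x ∂(E S : Measure (OnePoint Δ)) := by
      intro S
      exact (integral_indicator_one hcl.isOpen.measurableSet).symm
    rw [continuous_iff_continuousAt]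
    intro S
    have h := (ProbabilityMeasure.tendsto_iff_forall_integral_tendsto.1 (hE.tendsto S)) f
    unfold ContinuousAt
    rw [hf S]
    exact h.congr fun T => (hf T).symm
  have hex : ∀ a : Δ, ∃ F : Set Δ, F.Finite ∧ a ∈ F ∧ ∀ b c, b ∉ F → c ∉ F →
      |w a (tri (a : OnePoint Δ) b c) - w a (tri (a : OnePoint Δ) OnePoint.infty OnePoint.infty)|
        < 1 / 20 := by
    intro a
    have h := ((hw a).tendsto _).comp (tri_tendsto Δ a)
    have h2 := Metric.tendsto_nhds.1 h (1 / 20) (by norm_num)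
    obtain ⟨t, ht, hts⟩ := mem_prod_same_iff.1 h2
    refine ⟨insert a tᶜ, (mem_cofinite.1 ht).insert a, Set.mem_insert _ _, ?_⟩
    intro b c hb hc
    have hb' : b ∈ t := by by_contra hn; exact hb (Or.inr hn)
    have hc' : c ∈ t := by by_contra hn; exact hc (Or.inr hn)
    have h3 := hts (Set.mk_mem_prod hb' hc')
    rw [Set.mem_setOf_eq, Real.dist_eq] at h3
    exact h3
  choose F hFf hFa hF using hex
  obtain ⟨a, b, c, hba, hca, hab, hcb, hac, hbc⟩ := free_triple F hFf
  have nab : (a : OnePoint Δ) ≠ b := fun h => hab (OnePoint.coe_injective h ▸ hFa b)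
  have nac : (a : OnePoint Δ) ≠ c := fun h => hac (OnePoint.coe_injective h ▸ hFa c)
  have nbc : (b : OnePoint Δ) ≠ c := fun h => hbc (OnePoint.coe_injective h ▸ hFa c)
  have hone : ∀ S : SubLe (OnePoint Δ) 3,
      (E S : Measure (OnePoint Δ)).real S.1.toSet = 1 := by
    intro S
    have hm : MeasurableSet S.1.toSet := S.2.2.1.isClosed.measurableSet
    rw [measureReal_def, (prob_compl_eq_zero_iff hm).1 (hsupp S)]
    rfl
  have hpair : ∀ x y : Δ, (x : OnePoint Δ) ≠ y →
      w x (tri (x : OnePoint Δ) y y) + w y (tri (y : OnePoint Δ) x x) = 1 := by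
    intro x y hxy
    rw [tri_ext (show ({(y : OnePoint Δ), (x : OnePoint Δ), (x : OnePoint Δ)} : Set _)
      = {(x : OnePoint Δ), (y : OnePoint Δ), (y : OnePoint Δ)} by ext; simp; tauto)]
    rw [← hone (tri (x : OnePoint Δ) y y), tri_toSet, Set.pair_eq_singleton, Set.insert_eq,
      measureReal_union (by simpa using hxy) (measurableSet_singleton _)]
  have htri : w a (tri (a : OnePoint Δ) b c) + (w b (tri (b : OnePoint Δ) a c) +
      w c (tri (c : OnePoint Δ) a b)) = 1 := by
    rw [tri_ext (show ({(b : OnePoint Δ), (a : OnePoint Δ), (c : OnePoint Δ)} : Set _)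
      = {(a : OnePoint Δ), (b : OnePoint Δ), (c : OnePoint Δ)} by ext; simp; tauto),
      tri_ext (show ({(c : OnePoint Δ), (a : OnePoint Δ), (b : OnePoint Δ)} : Set _)
      = {(a : OnePoint Δ), (b : OnePoint Δ), (c : OnePoint Δ)} by ext; simp; tauto)]
    rw [← hone (tri (a : OnePoint Δ) b c), tri_toSet, Set.insert_eq,
      measureReal_union (by simp [nab, nac])
        ((Set.toFinite _).isClosed.measurableSet), Set.insert_eq (b : OnePoint Δ),
      measureReal_union (by simpa using nbc) (measurableSet_singleton _)]
  have e1 := abs_lt.1 (hF a b b hba hba)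
  have e2 := abs_lt.1 (hF b a a hab hab)
  have e3 := abs_lt.1 (hF a c c hca hca)
  have e4 := abs_lt.1 (hF c a a hac hac)
  have e5 := abs_lt.1 (hF b c c hcb hcb)
  have e6 := abs_lt.1 (hF c b b hbc hbc)
  have e7 := abs_lt.1 (hF a b c hba hca)
  have e8 := abs_lt.1 (hF b a c hab hcb)
  have e9 := abs_lt.1 (hF c a b hac hbc)
  have p1 := hpair a b nab
  have p2 := hpair a c nac
  have p3 := hpair b c nbc
  linarith [e1.1, e1.2, e2.1, e2.2, e3.1, e3.2, e4.1, e4.2, e5.1, e5.2, e6.1, e6.2,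
    e7.1, e7.2, e8.1, e8.2, e9.1, e9.2]
end
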